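/- arXiv:1706.08854 — 2 statements merged into one kernel-verified Lean document; each statement's English description precedes it below -/
import Mathlib

section
/- Let n ≥ 2, let A = (a_{ij}) be a symmetric positive definite real n×n matrix with inverse (a^{ij}), and let b = (b_i) ∈ ℝⁿ with ‖b‖ := √(Σ_{i,j} a^{ij} b_i b_j). Suppose that for all real numbers s, b' with |s| ≤ b' ≤ ‖b‖ one has φ(b'², s) > 0 and φ(b'², s) − s φ₂(b'², s) + (b'² − s²) φ₂₂(b'², s) > 0. Then for every y ∈ ℝⁿ \ {0}, the matrix with entries ½ ∂²(F²)/∂y^i∂y^j, where F(y) = α(y) φ(b², β(y)/α(y)), is positive definite; that is, F is a Finsler metric (positive and strongly convex on ℝⁿ \ {0}). -/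
open Matrix

noncomputable section

variable {n : ℕ}

/-- The Riemannian norm `α(y) = √(Σ aᵢⱼ yⁱ yʲ)`. -/
def alphaFn (A : Matrix (Fin n) (Fin n) ℝ) (y : Fin n → ℝ) : ℝ :=
  Real.sqrt (y ⬝ᵥ A.mulVec y)

/-- The 1-form `β(y) = Σ bᵢ yⁱ`. -/
def betaFn (b y : Fin n → ℝ) : ℝ := b ⬝ᵥ y

/-- `b² = Σ aⁱʲ bᵢ bⱼ`, the squared `α`-norm of `β`. -/
def bsq (A : Matrix (Fin n) (Fin n) ℝ) (b : Fin n → ℝ) : ℝ := b ⬝ᵥ A⁻¹.mulVec b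

/-- `φ₂`, the partial derivative of `φ` with respect to its second variable. -/
def phi2 (φ : ℝ → ℝ → ℝ) (t s : ℝ) : ℝ := deriv (φ t) s

/-- `φ₂₂`, the second partial derivative of `φ` with respect to its second variable. -/
def phi22 (φ : ℝ → ℝ → ℝ) (t s : ℝ) : ℝ := deriv (phi2 φ t) s

/-- The general `(α,β)`-metric `F(y) = α(y) φ(b², β(y)/α(y))`. -/
def Fgen (A : Matrix (Fin n) (Fin n) ℝ) (b : Fin n → ℝ) (φ : ℝ → ℝ → ℝ)
    (y : Fin n → ℝ) : ℝ :=
  alphaFn A y * φ (bsq A b) (betaFn b y / alphaFn A y)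


/-- Positivity of `f - s f'` follows from the second-order condition. -/
lemma aux_gpos_nonneg (f f1 f2 : ℝ → ℝ) (h1 : ∀ x, HasDerivAt f (f1 x) x)
    (h2 : ∀ x, HasDerivAt f1 (f2 x) x) (B : ℝ)
    (hc : ∀ s, |s| ≤ B → 0 < f s - s * f1 s + (B ^ 2 - s ^ 2) * f2 s)
    (s : ℝ) (hs0 : 0 ≤ s) (hs : s ≤ B) : 0 < f s - s * f1 s := by
  rcases hs.eq_or_lt with rfl | hlt
  · have := hc s (by rw [abs_of_nonneg hs0])
    simpa using this
  have hanti : StrictAntiOn (fun x => Real.sqrt (B ^ 2 - x ^ 2) * (f x - x * f1 x))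
      (Set.Icc 0 B) := by
    apply strictAntiOn_of_deriv_neg (convex_Icc 0 B)
    · have hf : Continuous f := continuous_iff_continuousAt.2 fun x => (h1 x).continuousAt
      have hf1 : Continuous f1 := continuous_iff_continuousAt.2 fun x => (h2 x).continuousAt
      exact Continuous.continuousOn (by fun_prop)
    · intro x hx
      rw [interior_Icc] at hx
      obtain ⟨hx0, hxB⟩ := hx
      have hq : 0 < B ^ 2 - x ^ 2 := by nlinarith
      have hd1 : HasDerivAt (fun x : ℝ => B ^ 2 - x ^ 2) (-(2 * x)) x := by
        simpa using (hasDerivAt_pow 2 x).const_sub (B ^ 2)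
      have hd := (hd1.sqrt hq.ne').mul ((h1 x).sub ((hasDerivAt_id x).mul (h2 x)))
      have hd' : deriv (fun x => Real.sqrt (B ^ 2 - x ^ 2) * (f x - x * f1 x)) x = _ :=
        hd.deriv
      rw [hd']
      have hc' := hc x (by rw [abs_of_pos hx0]; exact hxB.le)
      have ha : 0 < Real.sqrt (B ^ 2 - x ^ 2) := Real.sqrt_pos.2 hq
      have hsq : Real.sqrt (B ^ 2 - x ^ 2) ^ 2 = B ^ 2 - x ^ 2 := Real.sq_sqrt hq.le
      simp only [Pi.sub_apply, Pi.mul_apply, id]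
      rw [← hsq] at hc'
      generalize Real.sqrt (B ^ 2 - x ^ 2) = a at *
      have : -(2 * x) / (2 * a) * (f x - x * f1 x) + a * (f1 x - (1 * f1 x + x * f2 x))
          = - (x / a * (f x - x * f1 x + a ^ 2 * f2 x)) := by
        field_simp
        ring
      rw [this]
      have := mul_pos (div_pos hx0 ha) hc'
      linarith
  have := hanti ⟨hs0, hs⟩ ⟨hs0.trans hs, le_rfl⟩ hlt
  simp only [sub_self, Real.sqrt_zero, zero_mul] at this
  exact pos_of_mul_pos_right this (Real.sqrt_nonneg _)

lemma aux_gpos (f f1 f2 : ℝ → ℝ) (h1 : ∀ x, HasDerivAt f (f1 x) x)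
    (h2 : ∀ x, HasDerivAt f1 (f2 x) x) (B : ℝ)
    (hc : ∀ s, |s| ≤ B → 0 < f s - s * f1 s + (B ^ 2 - s ^ 2) * f2 s)
    (s : ℝ) (hs : |s| ≤ B) : 0 < f s - s * f1 s := by
  rcases le_total 0 s with h | h
  · exact aux_gpos_nonneg f f1 f2 h1 h2 B hc s h ((le_abs_self s).trans hs)
  · have := aux_gpos_nonneg (fun x => f (-x)) (fun x => - f1 (-x)) (fun x => f2 (-x))
      (fun x => ((h1 (-x)).comp x (hasDerivAt_neg x)).congr_deriv (by simp))
      (fun x => ((h2 (-x)).comp x (hasDerivAt_neg x)).neg.congr_deriv (by simp)) B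
      (fun x hx => by
        have := hc (-x) (by simpa using hx)
        simp at this ⊢
        linarith) (-s) (by linarith) ((neg_le_abs s).trans hs)
    simp at this
    linarith

lemma aux_dS (P R q0 l0 k t : ℝ) (hq : 0 < q0 + 2 * t * P + t ^ 2 * R) :
    HasDerivAt (fun t : ℝ => Real.sqrt (q0 + 2 * t * P + t ^ 2 * R))
      ((P + t * R) / Real.sqrt (q0 + 2 * t * P + t ^ 2 * R)) t ∧
    HasDerivAt (fun t : ℝ => (l0 + t * k) / Real.sqrt (q0 + 2 * t * P + t ^ 2 * R))
      ((k - (l0 + t * k) * (P + t * R) / (q0 + 2 * t * P + t ^ 2 * R))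
        / Real.sqrt (q0 + 2 * t * P + t ^ 2 * R)) t := by
  have ha : 0 < Real.sqrt (q0 + 2 * t * P + t ^ 2 * R) := Real.sqrt_pos.2 hq
  have hsq : Real.sqrt (q0 + 2 * t * P + t ^ 2 * R) ^ 2 = q0 + 2 * t * P + t ^ 2 * R :=
    Real.sq_sqrt hq.le
  have hd1 : HasDerivAt (fun t : ℝ => q0 + 2 * t * P + t ^ 2 * R) (2 * (P + t * R)) t := by
    have := ((((hasDerivAt_id t).const_mul 2).mul_const P).const_add q0).add
      ((hasDerivAt_pow 2 t).mul_const R)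
    refine this.congr_deriv ?_
    simp
    ring
  have hA : HasDerivAt (fun t : ℝ => Real.sqrt (q0 + 2 * t * P + t ^ 2 * R))
      ((P + t * R) / Real.sqrt (q0 + 2 * t * P + t ^ 2 * R)) t := by
    refine (hd1.sqrt hq.ne').congr_deriv ?_
    field_simp
  have hL : HasDerivAt (fun t : ℝ => l0 + t * k) k t := by
    simpa using ((hasDerivAt_id t).mul_const k).const_add l0
  refine ⟨hA, (hL.div hA ha.ne').congr_deriv ?_⟩
  rw [← hsq]
  simp only [Real.sqrt_sq ha.le]
  generalize Real.sqrt (q0 + 2 * t * P + t ^ 2 * R) = a at *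
  field_simp

lemma aux_d1 (f f1 : ℝ → ℝ) (h1 : ∀ x, HasDerivAt f (f1 x) x)
    (P R q0 l0 k t : ℝ) (hq : 0 < q0 + 2 * t * P + t ^ 2 * R) :
    HasDerivAt (fun t : ℝ => Real.sqrt (q0 + 2 * t * P + t ^ 2 * R) *
        f ((l0 + t * k) / Real.sqrt (q0 + 2 * t * P + t ^ 2 * R)))
      ((P + t * R) / Real.sqrt (q0 + 2 * t * P + t ^ 2 * R) *
        (f ((l0 + t * k) / Real.sqrt (q0 + 2 * t * P + t ^ 2 * R)) -
        (l0 + t * k) / Real.sqrt (q0 + 2 * t * P + t ^ 2 * R) *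
          f1 ((l0 + t * k) / Real.sqrt (q0 + 2 * t * P + t ^ 2 * R))) +
        f1 ((l0 + t * k) / Real.sqrt (q0 + 2 * t * P + t ^ 2 * R)) * k) t := by
  obtain ⟨hA, hS⟩ := aux_dS P R q0 l0 k t hq
  have ha : 0 < Real.sqrt (q0 + 2 * t * P + t ^ 2 * R) := Real.sqrt_pos.2 hq
  have hsq : Real.sqrt (q0 + 2 * t * P + t ^ 2 * R) ^ 2 = q0 + 2 * t * P + t ^ 2 * R :=
    Real.sq_sqrt hq.le
  refine (hA.mul ((h1 _).comp t hS)).congr_deriv ?_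
  simp only [Function.comp]
  rw [← hsq]
  simp only [Real.sqrt_sq ha.le]
  generalize Real.sqrt (q0 + 2 * t * P + t ^ 2 * R) = a at *
  generalize l0 + t * k = l at *
  generalize f (l / a) = u at *
  generalize f1 (l / a) = u1 at *
  field_simp
  ring

lemma aux_d2 (f f1 f2 : ℝ → ℝ) (h1 : ∀ x, HasDerivAt f (f1 x) x)
    (h2 : ∀ x, HasDerivAt f1 (f2 x) x)
    (P R q0 l0 k t : ℝ) (hq : 0 < q0 + 2 * t * P + t ^ 2 * R) :
    HasDerivAt (fun t : ℝ => (P + t * R) / Real.sqrt (q0 + 2 * t * P + t ^ 2 * R) *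
        (f ((l0 + t * k) / Real.sqrt (q0 + 2 * t * P + t ^ 2 * R)) -
        (l0 + t * k) / Real.sqrt (q0 + 2 * t * P + t ^ 2 * R) *
          f1 ((l0 + t * k) / Real.sqrt (q0 + 2 * t * P + t ^ 2 * R))) +
        f1 ((l0 + t * k) / Real.sqrt (q0 + 2 * t * P + t ^ 2 * R)) * k)
      (((f ((l0 + t * k) / Real.sqrt (q0 + 2 * t * P + t ^ 2 * R)) -
        (l0 + t * k) / Real.sqrt (q0 + 2 * t * P + t ^ 2 * R) *
          f1 ((l0 + t * k) / Real.sqrt (q0 + 2 * t * P + t ^ 2 * R))) *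
          (R - (P + t * R) ^ 2 / (q0 + 2 * t * P + t ^ 2 * R)) +
        f2 ((l0 + t * k) / Real.sqrt (q0 + 2 * t * P + t ^ 2 * R)) *
          (k - (l0 + t * k) * (P + t * R) / (q0 + 2 * t * P + t ^ 2 * R)) ^ 2) /
          Real.sqrt (q0 + 2 * t * P + t ^ 2 * R)) t := by
  obtain ⟨hA, hS⟩ := aux_dS P R q0 l0 k t hq
  obtain ⟨-, hM⟩ := aux_dS P R q0 P R t hq
  have ha : 0 < Real.sqrt (q0 + 2 * t * P + t ^ 2 * R) := Real.sqrt_pos.2 hq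
  have hsq : Real.sqrt (q0 + 2 * t * P + t ^ 2 * R) ^ 2 = q0 + 2 * t * P + t ^ 2 * R :=
    Real.sq_sqrt hq.le
  refine ((hM.mul (((h1 _).comp t hS).sub (hS.mul ((h2 _).comp t hS)))).add
    (((h2 _).comp t hS).mul_const k)).congr_deriv ?_
  simp only [Function.comp, Pi.sub_apply, Pi.mul_apply]
  rw [← hsq]
  simp only [Real.sqrt_sq ha.le]
  generalize Real.sqrt (q0 + 2 * t * P + t ^ 2 * R) = a at *
  generalize l0 + t * k = l at *
  generalize P + t * R = m at *
  generalize f (l / a) = u at *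
  generalize f1 (l / a) = u1 at *
  generalize f2 (l / a) = u2 at *
  field_simp
  ring

/-- The matrix of second derivatives and the second derivative along a line. -/
lemma aux_hess {n : ℕ} (G : (Fin n → ℝ) → ℝ) (y : Fin n → ℝ) (hG : ContDiffAt ℝ 2 G y) :
    (∀ u v : Fin n → ℝ, fderiv ℝ (fun z => fderiv ℝ G z u) y v = fderiv ℝ (fderiv ℝ G) y v u) ∧
    (∀ u v, fderiv ℝ (fderiv ℝ G) y u v = fderiv ℝ (fderiv ℝ G) y v u) ∧
    (∀ v (g1 : ℝ → ℝ) (c : ℝ),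
      (∀ᶠ t in nhds (0 : ℝ), HasDerivAt (fun t : ℝ => G (y + t • v)) (g1 t) t) →
      HasDerivAt g1 c 0 → fderiv ℝ (fderiv ℝ G) y v v = c) := by
  have hd : DifferentiableAt ℝ (fderiv ℝ G) y :=
    (hG.fderiv_right (m := 1) (by norm_num)).differentiableAt (by norm_num)
  refine ⟨fun u v => ?_, fun u v => ?_, fun v g1 c hg hc => ?_⟩
  · rw [fderiv_clm_apply hd (by fun_prop)]
    simp
  · exact hG.isSymmSndFDerivAt (by simp) u v
  · have hline : ∀ t : ℝ, HasDerivAt (fun t : ℝ => y + t • v) v t := fun t => by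
      simpa using ((hasDerivAt_id t).smul_const v).const_add y
    have hev : ∀ᶠ z in nhds y, DifferentiableAt ℝ G z := by
      filter_upwards [hG.eventually (by simp)] with z hz
      exact hz.differentiableAt (by norm_num)
    have hev' : ∀ᶠ t in nhds (0 : ℝ), DifferentiableAt ℝ G (y + t • v) := by
      have := (hline 0).continuousAt.tendsto
      simp only [zero_smul, add_zero] at this
      exact this.eventually hev
    have heq : g1 =ᶠ[nhds 0] fun t => fderiv ℝ G (y + t • v) v := by
      filter_upwards [hg, hev'] with t h1 h2
      exact h1.unique (h2.hasFDerivAt.comp_hasDerivAt t (hline t))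
    have h3 : HasDerivAt (fun t : ℝ => fderiv ℝ G (y + t • v)) (fderiv ℝ (fderiv ℝ G) y v) 0 := by
      have : HasFDerivAt (fderiv ℝ G) (fderiv ℝ (fderiv ℝ G) y) (y + (0 : ℝ) • v) := by
        simpa using hd.hasFDerivAt
      exact this.comp_hasDerivAt 0 (hline 0)
    have h4 : HasDerivAt (fun t : ℝ => fderiv ℝ G (y + t • v) v)
        (fderiv ℝ (fderiv ℝ G) y v v) 0 := by
      simpa using h3.clm_apply (hasDerivAt_const (0 : ℝ) v)
    exact (h4.congr_of_eventuallyEq heq).unique hc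

lemma aux_symm {n : ℕ} (A : Matrix (Fin n) (Fin n) ℝ) (hA : A.PosDef) (u v : Fin n → ℝ) :
    u ⬝ᵥ A.mulVec v = v ⬝ᵥ A.mulVec u := by
  have hT : Aᵀ = A := by simpa using hA.isHermitian.eq
  rw [Matrix.dotProduct_mulVec, ← Matrix.mulVec_transpose, hT, dotProduct_comm]

lemma aux_Qpos {n : ℕ} (A : Matrix (Fin n) (Fin n) ℝ) (hA : A.PosDef) (u : Fin n → ℝ)
    (hu : u ≠ 0) : 0 < u ⬝ᵥ A.mulVec u := by
  simpa using hA.dotProduct_mulVec_pos hu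

lemma aux_Qline {n : ℕ} (A : Matrix (Fin n) (Fin n) ℝ) (hA : A.PosDef) (u v : Fin n → ℝ) (t : ℝ) :
    (u + t • v) ⬝ᵥ A.mulVec (u + t • v) =
      u ⬝ᵥ A.mulVec u + 2 * t * (u ⬝ᵥ A.mulVec v) + t ^ 2 * (v ⬝ᵥ A.mulVec v) := by
  simp only [Matrix.mulVec_add, Matrix.mulVec_smul, add_dotProduct, dotProduct_add,
    smul_dotProduct, dotProduct_smul, smul_eq_mul, aux_symm A hA v u]
  ring

/-- Bessel-type inequality. -/
lemma aux_bessel {n : ℕ} (A : Matrix (Fin n) (Fin n) ℝ) (hA : A.PosDef) (b u w : Fin n → ℝ)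
    (hu : u ≠ 0) (ho : u ⬝ᵥ A.mulVec w = 0) :
    (b ⬝ᵥ u) ^ 2 / (u ⬝ᵥ A.mulVec u) + (b ⬝ᵥ w) ^ 2 / (w ⬝ᵥ A.mulVec w) ≤ bsq A b := by
  have hdet : IsUnit A.det := (Matrix.isUnit_iff_isUnit_det A).1 hA.isUnit
  have hAx : A.mulVec (A⁻¹.mulVec b) = b := by
    rw [Matrix.mulVec_mulVec, Matrix.mul_nonsing_inv _ hdet, Matrix.one_mulVec]
  set x := A⁻¹.mulVec b with hx
  have hb : ∀ z, b ⬝ᵥ z = z ⬝ᵥ A.mulVec x := fun z => by rw [hAx, dotProduct_comm]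
  have hbsq : bsq A b = x ⬝ᵥ A.mulVec x := by rw [bsq, ← hx, hb]
  have hQ := (aux_Qpos A hA u hu).ne'
  set U := u ⬝ᵥ A.mulVec u with hU
  set W := w ⬝ᵥ A.mulVec w with hW
  have hn : ∀ z, 0 ≤ z ⬝ᵥ A.mulVec z := fun z => by
    by_cases hz : z = 0
    · simp [hz]
    · exact (aux_Qpos A hA z hz).le
  have key := hn (x + (-1 : ℝ) • ((b ⬝ᵥ u / U) • u + (b ⬝ᵥ w / W) • w))
  have e : (x + (-1 : ℝ) • ((b ⬝ᵥ u / U) • u + (b ⬝ᵥ w / W) • w)) ⬝ᵥ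
      A.mulVec (x + (-1 : ℝ) • ((b ⬝ᵥ u / U) • u + (b ⬝ᵥ w / W) • w)) =
      bsq A b - ((b ⬝ᵥ u) ^ 2 / U + (b ⬝ᵥ w) ^ 2 / W) := by
    have hwu : w ⬝ᵥ A.mulVec u = 0 := by rw [aux_symm A hA, ho]
    simp only [Matrix.mulVec_add, Matrix.mulVec_smul, add_dotProduct, dotProduct_add,
      smul_dotProduct, dotProduct_smul, smul_eq_mul, aux_symm A hA x, ← hb, ho, hwu, ← hU, ← hW]
    rw [show b ⬝ᵥ x = bsq A b from rfl]
    by_cases hW0 : W = 0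
    · simp [hW0]
      field_simp
      ring
    · field_simp
      ring
  linarith

theorem Fgen_is_Finsler (n : ℕ) (hn : 2 ≤ n) (A : Matrix (Fin n) (Fin n) ℝ)
    (hA : A.PosDef) (b : Fin n → ℝ) (φ : ℝ → ℝ → ℝ)
    (hφ : ContDiff ℝ (⊤ : ℕ∞) (Function.uncurry φ))
    (hpos : ∀ s b' : ℝ, |s| ≤ b' → b' ≤ Real.sqrt (bsq A b) →
      0 < φ (b' ^ 2) s ∧
      0 < φ (b' ^ 2) s - s * phi2 φ (b' ^ 2) s
          + (b' ^ 2 - s ^ 2) * phi22 φ (b' ^ 2) s)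
    (y : Fin n → ℝ) (hy : y ≠ 0) :
    0 < Fgen A b φ y ∧
    (Matrix.of fun i j =>
      (1 / 2 : ℝ) *
        fderiv ℝ (fun z => fderiv ℝ (fun w => (Fgen A b φ w) ^ 2) z (Pi.single i 1))
          y (Pi.single j 1)).PosDef := by
  have hQ := aux_Qpos A hA y hy
  have hα : 0 < alphaFn A y := Real.sqrt_pos.2 hQ
  set f := φ (bsq A b) with hf
  have hfc : ContDiff ℝ (⊤ : ℕ∞) f := by
    have : ContDiff ℝ (⊤ : ℕ∞) (fun s : ℝ => Function.uncurry φ (bsq A b, s)) := by fun_prop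
    exact this
  have h1 : ∀ x, HasDerivAt f (phi2 φ (bsq A b) x) x := fun x =>
    (hfc.differentiable (by simp) x).hasDerivAt
  have hf1c : ContDiff ℝ 1 (deriv f) :=
    ((contDiff_succ_iff_deriv (n := 1)).1 (hfc.of_le (by norm_cast))).2.2
  have h2 : ∀ x, HasDerivAt (phi2 φ (bsq A b)) (phi22 φ (bsq A b) x) x := fun x =>
    (hf1c.differentiable (by simp) x).hasDerivAt
  have hbn : 0 ≤ bsq A b := by
    refine le_trans ?_ (aux_bessel A hA b y 0 hy (by simp))
    simp
    positivity
  set B := Real.sqrt (bsq A b) with hB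
  have hBsq : B ^ 2 = bsq A b := Real.sq_sqrt hbn
  have hBn : 0 ≤ B := Real.sqrt_nonneg _
  have hcond : ∀ s, |s| ≤ B → 0 < f s ∧ 0 < f s - s * phi2 φ (bsq A b) s
      + (B ^ 2 - s ^ 2) * phi22 φ (bsq A b) s := fun s hs => by
    have := hpos s B hs le_rfl
    rw [hBsq] at this
    rw [hBsq]
    exact this
  have hαsq : alphaFn A y ^ 2 = y ⬝ᵥ A.mulVec y := Real.sq_sqrt hQ.le
  set s := betaFn b y / alphaFn A y with hs
  have hssq : s ^ 2 = (b ⬝ᵥ y) ^ 2 / (y ⬝ᵥ A.mulVec y) := by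
    rw [hs, div_pow, hαsq, betaFn]
  have hsB : |s| ≤ B := by
    apply abs_le_of_sq_le_sq _ hBn
    rw [hBsq, hssq]
    simpa using aux_bessel A hA b y 0 hy (by simp)
  have hg := aux_gpos f _ _ h1 h2 B (fun s hs => (hcond s hs).2) s hsB
  obtain ⟨hfs, hc2⟩ := hcond s hsB
  have hF : 0 < Fgen A b φ y := mul_pos hα hfs
  refine ⟨hF, ?_⟩
  have hG : ContDiffAt ℝ 2 (fun w => (Fgen A b φ w) ^ 2) y := by
    have hq : ContDiff ℝ 2 (fun w : Fin n → ℝ => w ⬝ᵥ A.mulVec w) := by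
      simp only [dotProduct, Matrix.mulVec]
      fun_prop
    have hl : ContDiff ℝ 2 (fun w : Fin n → ℝ => betaFn b w) := by
      simp only [betaFn, dotProduct]
      fun_prop
    have ha : ContDiffAt ℝ 2 (fun w : Fin n → ℝ => alphaFn A w) y :=
      hq.contDiffAt.sqrt hQ.ne'
    have hf2 : ContDiff ℝ 2 f := hfc.of_le (by norm_cast)
    have hdv := hl.contDiffAt.div ha hα.ne'
    exact (ha.mul (hf2.contDiffAt.comp y hdv)).pow 2
  obtain ⟨e1, e2, e3⟩ := aux_hess _ y hG
  simp only [e1]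
  set D := fderiv ℝ (fderiv ℝ (fun w => (Fgen A b φ w) ^ 2)) y with hD
  apply Matrix.PosDef.of_dotProduct_mulVec_pos
  · ext i j
    simp [e2 (Pi.single i 1)]
  intro v hv
  have hsum : star v ⬝ᵥ ((Matrix.of fun i j => (1 / 2 : ℝ) *
      D (Pi.single j 1) (Pi.single i 1)) *ᵥ v) = 1 / 2 * D v v := by
    have hv' : v = ∑ i, v i • (Pi.single i (1 : ℝ) : Fin n → ℝ) := by
      simpa using (pi_eq_sum_univ' v)
    conv_rhs => rw [hv']
    simp only [map_sum, map_smul, _root_.sum_apply, _root_.smul_apply,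
      smul_eq_mul, dotProduct, Matrix.mulVec, Matrix.of_apply, star_trivial, Finset.mul_sum]
    refine Finset.sum_congr rfl fun i _ => Finset.sum_congr rfl fun j _ => ?_
    ring
  rw [hsum]
  set q0 := y ⬝ᵥ A.mulVec y with hq0
  set P := y ⬝ᵥ A.mulVec v with hP
  set R := v ⬝ᵥ A.mulVec v with hR
  have hline : ∀ t : ℝ, Fgen A b φ (y + t • v) = Real.sqrt (q0 + 2 * t * P + t ^ 2 * R) *
        f ((b ⬝ᵥ y + t * (b ⬝ᵥ v)) / Real.sqrt (q0 + 2 * t * P + t ^ 2 * R)) := fun t => by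
    simp only [Fgen, alphaFn, betaFn, aux_Qline A hA, dotProduct_add, dotProduct_smul,
      smul_eq_mul, ← hf, ← hq0, ← hP, ← hR]
  have hqc : ∀ᶠ t in nhds (0 : ℝ), 0 < q0 + 2 * t * P + t ^ 2 * R := by
    have : ContinuousAt (fun t : ℝ => q0 + 2 * t * P + t ^ 2 * R) 0 := by fun_prop
    exact this.eventually_const_lt (by simpa using hQ)
  have hsec := e3 v _ _ (by
    filter_upwards [hqc] with t ht
    simp only [hline]
    exact (aux_d1 f _ h1 P R q0 (b ⬝ᵥ y) (b ⬝ᵥ v) t ht).pow 2)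
    (((aux_d1 f _ h1 P R q0 (b ⬝ᵥ y) (b ⬝ᵥ v) 0 (by simpa using hQ)).pow 1 |>.const_mul (2 : ℝ)).mul
      (aux_d2 f _ _ h1 h2 P R q0 (b ⬝ᵥ y) (b ⬝ᵥ v) 0 (by simpa using hQ)))
  have hαe : Real.sqrt q0 = alphaFn A y := rfl
  have hse : b ⬝ᵥ y / alphaFn A y = s := rfl
  set w := v + (-(P / q0)) • y with hw
  have hPv : v ⬝ᵥ A.mulVec y = P := aux_symm A hA v y
  have how : y ⬝ᵥ A.mulVec w = 0 := by
    rw [hw, Matrix.mulVec_add, Matrix.mulVec_smul, dotProduct_add, dotProduct_smul, ← hP, ← hq0,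
      smul_eq_mul]
    field_simp
    ring
  have hQw : w ⬝ᵥ A.mulVec w = R - P ^ 2 / q0 := by
    rw [hw, aux_Qline A hA, hPv, ← hR, ← hq0]
    field_simp
    ring
  have hbw : b ⬝ᵥ w = b ⬝ᵥ v - b ⬝ᵥ y * P / q0 := by
    rw [hw, dotProduct_add, dotProduct_smul, smul_eq_mul]
    ring
  have hfin : 1 / 2 * D v v =
      (P / alphaFn A y * (f s - s * phi2 φ (bsq A b) s) + phi2 φ (bsq A b) s * (b ⬝ᵥ v)) ^ 2 +
      f s * ((f s - s * phi2 φ (bsq A b) s) * (w ⬝ᵥ A.mulVec w) +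
        phi22 φ (bsq A b) s * (b ⬝ᵥ w) ^ 2) := by
    rw [hsec, hQw, hbw]
    simp [hαe, hse]
    field_simp
  rw [hfin]
  by_cases hw0 : w = 0
  · have hvy : v = (P / q0) • y := by
      have : v = w + (P / q0) • y := by rw [hw]; module
      rw [hw0, zero_add] at this
      exact this
    have hP0 : P ≠ 0 := by
      intro h
      apply hv
      rw [hvy, h]
      simp
    have hbv : b ⬝ᵥ v = P / alphaFn A y * s := by
      rw [hvy, dotProduct_smul, smul_eq_mul, ← hse, ← hαsq]
      field_simp
    have e : P / alphaFn A y * (f s - s * phi2 φ (bsq A b) s) + phi2 φ (bsq A b) s * (b ⬝ᵥ v)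
        = P / alphaFn A y * f s := by
      rw [hbv]
      ring
    rw [e, hw0]
    simp only [zero_dotProduct, dotProduct_zero]
    have : P / alphaFn A y * f s ≠ 0 := mul_ne_zero (div_ne_zero hP0 hα.ne') hfs.ne'
    have h7 := pow_pos hfs 2
    have h8 : 0 < (P / alphaFn A y * f s) ^ 2 := by positivity
    simpa using h8
  · have hWp := aux_Qpos A hA w hw0
    have hbes := aux_bessel A hA b y w hy how
    rw [← hq0, ← hssq, ← hBsq] at hbes
    have hbw2 : (b ⬝ᵥ w) ^ 2 ≤ (B ^ 2 - s ^ 2) * (w ⬝ᵥ A.mulVec w) := by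
      rw [← div_le_iff₀ hWp]
      linarith
    apply add_pos_of_nonneg_of_pos (sq_nonneg _)
    apply mul_pos hfs
    rcases le_total 0 (phi22 φ (bsq A b) s) with h | h
    · have := mul_pos hg hWp
      have := mul_nonneg h (sq_nonneg (b ⬝ᵥ w))
      linarith
    · have h5 := mul_le_mul_of_nonpos_left hbw2 h
      have h6 := mul_pos hc2 hWp
      refine h6.trans_le ?_
      rw [add_mul]
      linarith [h5]
end
end

section
/- Let c₀, c₁, c₂ : (0,∞) → ℝ be differentiable functions with c₂(t) ≠ 0 for all t > 0, satisfying for all t > 0: (i) 2t c₂(t) + c₀(t) = 0, (ii) 2 c₁(t) c₂′(t) − 3 c₂(t) c₁′(t) = 0, and (iii) c₂(t)(2t c₂′(t) + 3 c₂(t) − 3 c₀′(t)) + c₀(t) c₂′(t) = 0. Then there exist constants a₀, a₁, a₂ ∈ ℝ such that c₀(t) = a₀/√t, c₁(t) = a₁/t, and c₂(t) = a₂/t^{3/2} for all t > 0. -/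
theorem const_of_hasDerivAt_zero (f : ℝ → ℝ) (h : ∀ t > (0 : ℝ), HasDerivAt f 0 t) :
    ∀ t > (0 : ℝ), f t = f 1 := by
  intro t ht
  refine (isOpen_Ioi (a := (0:ℝ))).is_const_of_deriv_eq_zero (isPreconnected_Ioi)
    (fun x hx => (h x hx).differentiableAt.differentiableWithinAt)
    (fun x hx => (h x hx).deriv) ht (by simp)

theorem ode_system_case_m_eq_two (c₀ c₁ c₂ : ℝ → ℝ)
    (hd₀ : ∀ t > (0 : ℝ), DifferentiableAt ℝ c₀ t)
    (hd₁ : ∀ t > (0 : ℝ), DifferentiableAt ℝ c₁ t)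
    (hd₂ : ∀ t > (0 : ℝ), DifferentiableAt ℝ c₂ t)
    (hne : ∀ t > (0 : ℝ), c₂ t ≠ 0)
    (h1 : ∀ t > (0 : ℝ), 2 * t * c₂ t + c₀ t = 0)
    (h2 : ∀ t > (0 : ℝ), 2 * c₁ t * deriv c₂ t - 3 * c₂ t * deriv c₁ t = 0)
    (h3 : ∀ t > (0 : ℝ),
      c₂ t * (2 * t * deriv c₂ t + 3 * c₂ t - 3 * deriv c₀ t)
        + c₀ t * deriv c₂ t = 0) :
    ∃ a₀ a₁ a₂ : ℝ, ∀ t > (0 : ℝ),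
      c₀ t = a₀ / Real.sqrt t ∧ c₁ t = a₁ / t ∧
        c₂ t = a₂ / t ^ ((3 : ℝ) / 2) := by
  have e0 : ∀ t > (0 : ℝ), deriv c₀ t = -2 * c₂ t - 2 * t * deriv c₂ t := by
    intro t ht
    have hA : HasDerivAt (fun x => (-2 * x) * c₂ x) (-2 * 1 * c₂ t + (-2 * t) * deriv c₂ t) t :=
      ((hasDerivAt_id' t).const_mul (-2)).mul (hd₂ t ht).hasDerivAt
    have hE : c₀ =ᶠ[nhds t] fun x => (-2 * x) * c₂ x := by
      filter_upwards [lt_mem_nhds ht] with x hx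
      linarith [h1 x hx]
    rw [(hA.congr_of_eventuallyEq hE).deriv]; ring
  have e2 : ∀ t > (0 : ℝ), 2 * t * deriv c₂ t + 3 * c₂ t = 0 := by
    intro t ht
    have h := h3 t ht
    rw [e0 t ht, show c₀ t = -2 * t * c₂ t by linarith [h1 t ht]] at h
    have : c₂ t * (3 * (2 * t * deriv c₂ t + 3 * c₂ t)) = 0 := by linear_combination h
    rcases mul_eq_zero.1 this with h | h
    · exact absurd h (hne t ht)
    · linarith
  have e1 : ∀ t > (0 : ℝ), c₁ t + t * deriv c₁ t = 0 := by
    intro t ht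
    have : c₂ t * (c₁ t + t * deriv c₁ t) = 0 := by
      linear_combination (-t / 3) * h2 t ht + (c₁ t / 3) * e2 t ht
    exact (mul_eq_zero.1 this).resolve_left (hne t ht)
  have k1 := const_of_hasDerivAt_zero (fun t => t * c₁ t) (by
    intro t ht
    have := (hasDerivAt_id' t).mul (hd₁ t ht).hasDerivAt
    refine HasDerivAt.congr_deriv this ?_
    linarith [e1 t ht])
  have hp : ∀ t > (0 : ℝ), t ^ ((3 : ℝ) / 2) = t * Real.sqrt t := by
    intro t ht
    rw [Real.sqrt_eq_rpow, show (3 : ℝ) / 2 = 1 + 1 / 2 by norm_num, Real.rpow_add ht,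
      Real.rpow_one]
  have k2 := const_of_hasDerivAt_zero (fun t => t ^ ((3 : ℝ) / 2) * c₂ t) (by
    intro t ht
    have := (Real.hasDerivAt_rpow_const (x := t) (p := 3 / 2) (Or.inl ht.ne')).mul
      (hd₂ t ht).hasDerivAt
    refine HasDerivAt.congr_deriv this ?_
    rw [hp t ht, show (3 : ℝ) / 2 - 1 = 1 / 2 by norm_num, ← Real.sqrt_eq_rpow]
    linear_combination (Real.sqrt t / 2) * e2 t ht)
  refine ⟨-2 * c₂ 1, c₁ 1, c₂ 1, fun t ht => ?_⟩
  have hs := Real.sqrt_pos.2 ht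
  have q1 := k1 t ht
  have q2 := k2 t ht
  simp only [one_mul, Real.one_rpow] at q1 q2
  rw [hp t ht] at q2 ⊢
  refine ⟨?_, ?_, ?_⟩
  · rw [eq_div_iff hs.ne']
    linear_combination Real.sqrt t * h1 t ht - 2 * q2
  · rw [eq_div_iff ht.ne']; linarith
  · rw [eq_div_iff (by positivity)]; linarith
end
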